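/- Let A > 0 and suppose that R(ξ,ξ,ξ,ξ) ≤ A·g(ξ,ξ)² for every ξ ∈ V. Then for every basis ξ_1,…,ξ_n of V that is orthonormal with respect to ĝ, the real number Σ_{α,β=1}^n R(ξ_α,ξ_α,ξ_β,ξ_β) satisfies Σ_{α,β=1}^n R(ξ_α,ξ_α,ξ_β,ξ_β) ≤ A·(Σ_{α=1}^n g(ξ_α,ξ_α))². (This is the pointwise, multilinear-algebra form of Royden's Schwarz-type lemma: in index notation, ĝ^{j̄i} ĝ^{q̄p} R_{i j̄ p q̄} ≤ A (tr_{ĝ} g)² whenever the holomorphic sectional curvature of R is bounded above by the positive constant A.) -/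

import Mathlib

open Complex in
/-- Averaging a Kähler-symmetric quartic form over the fourth roots of unity. -/
lemma kaehler_quartic_average {V : Type*} [AddCommGroup V] [Module ℂ V]
    (S : V → V → V → V → ℂ)
    (add1 : ∀ x x' y z w : V, S (x + x') y z w = S x y z w + S x' y z w)
    (smul1 : ∀ (a : ℂ) (x y z w : V), S (a • x) y z w = a * S x y z w)
    (sym13 : ∀ x y z w : V, S x y z w = S z y x w)
    (sym24 : ∀ x y z w : V, S x y z w = S x w z y)
    (conj : ∀ x y z w : V, S x y z w = starRingEnd ℂ (S y x w z)) (v a : V) :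
    (∑ k : Fin 4, S (v + I ^ (k : ℕ) • a) (v + I ^ (k : ℕ) • a)
        (v + I ^ (k : ℕ) • a) (v + I ^ (k : ℕ) • a) =
      4 * (S v v v v + S a a a a + 4 * S v v a a)) ∧
    ∀ b : V, ∑ k : Fin 4, S (v + I ^ (k : ℕ) • a) (v + I ^ (k : ℕ) • a) b b =
      4 * (S v v b b + S a a b b) := by
  have add2 (x y y' z w : V) : S x (y + y') z w = S x y z w + S x y' z w := by
    rw [conj, add1, map_add, ← conj, ← conj]
  have smul2 (c : ℂ) (x y z w : V) : S x (c • y) z w = starRingEnd ℂ c * S x y z w := by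
    rw [conj, smul1, map_mul, ← conj]
  have add3 (x y z z' w : V) : S x y (z + z') w = S x y z w + S x y z' w := by
    rw [sym13, add1, sym13 z, sym13 z']
  have smul3 (c : ℂ) (x y z w : V) : S x y (c • z) w = c * S x y z w := by
    rw [sym13, smul1, sym13 z]
  have add4 (x y z w w' : V) : S x y z (w + w') = S x y z w + S x y z w' := by
    rw [sym24, add2, sym24 x w, sym24 x w']
  have smul4 (c : ℂ) (x y z w : V) : S x y z (c • w) = starRingEnd ℂ c * S x y z w := by
    rw [sym24, smul2, sym24 x w]
  have hI : I ^ 2 = -1 := I_sq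
  have hI3 : I ^ 3 = -I := by rw [pow_succ, hI]; ring
  constructor
  · have h1 : S v a a v = S v v a a := sym24 v a a v
    have h2 : S a v v a = S v v a a := sym13 a v v a
    have h3 : S a a v v = S v v a a := by rw [sym13, sym24]
    simp only [Fin.sum_univ_four, add1, add2, add3, add4, smul1, smul2, smul3, smul4,
      Fin.val_zero, Fin.val_one, Fin.val_two, show ((3 : Fin 4) : ℕ) = 3 from rfl,
      pow_zero, pow_one, hI, hI3, map_neg, map_one, conj_I, h1, h2, h3]
    ring_nf
    simp only [show I ^ 4 = 1 from I_pow_four, hI]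
    ring
  · intro b
    simp only [Fin.sum_univ_four, add1, add2, smul1, smul2,
      Fin.val_zero, Fin.val_one, Fin.val_two, show ((3 : Fin 4) : ℕ) = 3 from rfl,
      pow_zero, pow_one, hI, hI3, map_neg, map_one, conj_I]
    ring_nf
    simp only [hI]
    ring

/-- A Kähler-symmetric form with nonnegative holomorphic sectional values has nonnegative
double trace along every finite family of vectors; `v` is a free vector for the induction. -/
lemma kaehler_trace_nonneg_aux {V ι : Type*} [AddCommGroup V] [Module ℂ V]
    (S : V → V → V → V → ℂ)
    (add1 : ∀ x x' y z w : V, S (x + x') y z w = S x y z w + S x' y z w)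
    (smul1 : ∀ (a : ℂ) (x y z w : V), S (a • x) y z w = a * S x y z w)
    (sym13 : ∀ x y z w : V, S x y z w = S z y x w)
    (sym24 : ∀ x y z w : V, S x y z w = S x w z y)
    (conj : ∀ x y z w : V, S x y z w = starRingEnd ℂ (S y x w z))
    (nonneg : ∀ v : V, 0 ≤ (S v v v v).re) (e : ι → V) (s : Finset ι) (v : V) :
    0 ≤ (S v v v v).re + 4 * ∑ i ∈ s, (S v v (e i) (e i)).re +
      2 * ∑ i ∈ s, ∑ j ∈ s, (S (e i) (e i) (e j) (e j)).re := by
  classical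
  induction s using Finset.induction_on generalizing v with
  | empty => simpa using nonneg v
  | insert a s ha ih =>
    obtain ⟨h4, h2⟩ := kaehler_quartic_average S add1 smul1 sym13 sym24 conj v (e a)
    have key := Finset.sum_nonneg fun (k : Fin 4) (_ : k ∈ Finset.univ) =>
      ih (v + Complex.I ^ (k : ℕ) • e a)
    have h4' := congrArg Complex.re h4
    have h2' (b : V) := congrArg Complex.re (h2 b)
    have hre (z : ℂ) : (4 * z).re = 4 * z.re := by simp
    simp only [Complex.re_sum, hre, Complex.add_re] at h4' h2'
    simp only [Finset.sum_add_distrib, ← Finset.mul_sum] at key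
    rw [h4', Finset.sum_comm] at key
    simp only [h2', ← Finset.mul_sum, Finset.sum_add_distrib, Finset.sum_const,
      Finset.card_univ, Fintype.card_fin, nsmul_eq_mul] at key
    have hsymm (i : ι) : S (e i) (e i) (e a) (e a) = S (e a) (e a) (e i) (e i) := by
      rw [sym13, sym24]
    simp only [Finset.sum_insert ha, Finset.sum_add_distrib, hsymm]
    push_cast at key
    linarith [nonneg (e a)]

/-- The Cauchy–Schwarz inequality for a positive definite Hermitian form. -/
lemma hermitian_mul_swap_re_le {V : Type*} [AddCommGroup V] [Module ℂ V] (g : V → V → ℂ)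
    (add : ∀ x y z : V, g (x + y) z = g x z + g y z)
    (smul : ∀ (a : ℂ) (x z : V), g (a • x) z = a * g x z)
    (conj : ∀ x y : V, g x y = starRingEnd ℂ (g y x))
    (pos : ∀ x : V, x ≠ 0 → 0 < (g x x).re) (x y : V) :
    (g x y * g y x).re ≤ (g x x).re * (g y y).re := by
  let c : PreInnerProductSpace.Core ℂ V :=
    { inner := fun x y => g y x
      conj_inner_symm := fun x y => (conj y x).symm
      re_inner_nonneg := fun x => by
        rcases eq_or_ne x 0 with rfl | hx
        · have h := smul 0 0 0
          simp only [zero_smul, zero_mul] at h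
          simp [h]
        · exact (pos x hx).le
      add_left := fun x y z => by rw [conj, add, map_add, ← conj, ← conj]
      smul_left := fun x y r => by rw [conj, smul, map_mul, ← conj] }
  have h : ‖g y x‖ * ‖g x y‖ ≤ (g x x).re * (g y y).re :=
    InnerProductSpace.Core.inner_mul_inner_self_le (c := c) x y
  calc (g x y * g y x).re ≤ ‖g x y * g y x‖ := Complex.re_le_norm _
    _ = ‖g y x‖ * ‖g x y‖ := by rw [norm_mul, mul_comm]
    _ ≤ _ := h


/-- **Royden's Schwarz-type lemma (pointwise, multilinear-algebra form).**
Let `V` be an `n`-dimensional complex vector space (`n ≥ 1`) equipped with two Hermitian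
inner products `g` and `ghat`, and let `R` be a Kähler curvature-type tensor on `V`
(ℂ-linear in the 1st and 3rd arguments, conjugate-linear in the 2nd and 4th, with the
Kähler symmetries). If `A > 0` and the holomorphic sectional curvature of `R` with respect
to `g` is bounded above by `A`, i.e. `R(ξ,ξ,ξ,ξ) ≤ A·g(ξ,ξ)²` for all `ξ`, then for every
basis `ξ_1,…,ξ_n` of `V` orthonormal with respect to `ghat` we have
`Σ_{α,β} R(ξ_α,ξ_α,ξ_β,ξ_β) ≤ A·(Σ_α g(ξ_α,ξ_α))²`. -/
theorem royden_pointwise_trace_estimate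
    (V : Type*) [AddCommGroup V] [Module ℂ V] [FiniteDimensional ℂ V]
    (n : ℕ) (hn : 1 ≤ n) (hdim : Module.finrank ℂ V = n)
    (g ghat : V → V → ℂ)
    -- `g` is a Hermitian inner product: linear in the first argument,
    -- conjugate-linear in the second, positive definite
    (hg_add : ∀ x y z : V, g (x + y) z = g x z + g y z)
    (hg_smul : ∀ (a : ℂ) (x z : V), g (a • x) z = a * g x z)
    (hg_conj : ∀ x y : V, g x y = starRingEnd ℂ (g y x))
    (hg_pos : ∀ x : V, x ≠ 0 → 0 < (g x x).re)
    -- `ghat` is a Hermitian inner product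
    (hh_add : ∀ x y z : V, ghat (x + y) z = ghat x z + ghat y z)
    (hh_smul : ∀ (a : ℂ) (x z : V), ghat (a • x) z = a * ghat x z)
    (hh_conj : ∀ x y : V, ghat x y = starRingEnd ℂ (ghat y x))
    (hh_pos : ∀ x : V, x ≠ 0 → 0 < (ghat x x).re)
    -- `R` is a Kähler curvature-type tensor: ℂ-linear in the 1st and 3rd arguments,
    -- conjugate-linear in the 2nd and 4th arguments
    (R : V → V → V → V → ℂ)
    (hR_add1 : ∀ x x' y z w : V, R (x + x') y z w = R x y z w + R x' y z w)
    (hR_smul1 : ∀ (a : ℂ) (x y z w : V), R (a • x) y z w = a * R x y z w)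
    (hR_add2 : ∀ x y y' z w : V, R x (y + y') z w = R x y z w + R x y' z w)
    (hR_smul2 : ∀ (a : ℂ) (x y z w : V), R x (a • y) z w = starRingEnd ℂ a * R x y z w)
    (hR_add3 : ∀ x y z z' w : V, R x y (z + z') w = R x y z w + R x y z' w)
    (hR_smul3 : ∀ (a : ℂ) (x y z w : V), R x y (a • z) w = a * R x y z w)
    (hR_add4 : ∀ x y z w w' : V, R x y z (w + w') = R x y z w + R x y z w')
    (hR_smul4 : ∀ (a : ℂ) (x y z w : V), R x y z (a • w) = starRingEnd ℂ a * R x y z w)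
    -- Kähler symmetries
    (hR_sym13 : ∀ x y z w : V, R x y z w = R z y x w)
    (hR_sym24 : ∀ x y z w : V, R x y z w = R x w z y)
    (hR_conj : ∀ x y z w : V, R x y z w = starRingEnd ℂ (R y x w z))
    -- holomorphic sectional curvature bounded above by the positive constant `A`
    (A : ℝ) (hA : 0 < A)
    (hHSC : ∀ ξ : V, (R ξ ξ ξ ξ).re ≤ A * ((g ξ ξ).re) ^ 2)
    -- `ξ` is a basis of `V` orthonormal with respect to `ghat`
    (ξ : Fin n → V)
    (hindep : LinearIndependent ℂ ξ)
    (hspan : Submodule.span ℂ (Set.range ξ) = ⊤)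
    (hortho : ∀ α β : Fin n, ghat (ξ α) (ξ β) = if α = β then 1 else 0) :
    (∑ α : Fin n, ∑ β : Fin n, R (ξ α) (ξ α) (ξ β) (ξ β)).re ≤
      A * (∑ α : Fin n, (g (ξ α) (ξ α)).re) ^ 2 := by
  have im_zero (x : V) : (g x x).im = 0 := Complex.conj_eq_iff_im.mp (hg_conj x x).symm
  let S : V → V → V → V → ℂ := fun x y z w =>
    (A / 2 : ℝ) * (g x y * g z w + g x w * g z y) - R x y z w
  have key := kaehler_trace_nonneg_aux S
    (fun x x' y z w => by simp only [S, hg_add, hR_add1]; ring)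
    (fun a x y z w => by simp only [S, hg_smul, hR_smul1]; ring)
    (fun x y z w => by simp only [S, hR_sym13 x y z w]; ring)
    (fun x y z w => by simp only [S, hR_sym24 x y z w]; ring)
    (fun x y z w => by
      simp only [S, map_sub, map_mul, map_add, Complex.conj_ofReal, ← hg_conj, ← hR_conj]
      ring)
    (fun v => by
      simp only [S, Complex.sub_re, Complex.re_ofReal_mul, Complex.add_re]
      simp only [Complex.mul_re, im_zero]
      linarith [hHSC v])
    ξ Finset.univ 0
  have S_zero (z w : V) : S 0 0 z w = 0 := by
    have hg0 (z : V) : g 0 z = 0 := by simpa using hg_smul 0 0 z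
    have hR0 : R 0 0 z w = 0 := by simpa using hR_smul1 0 0 0 z w
    simp [S, hg0, hR0]
  have S_le (i j : Fin n) : (S (ξ i) (ξ i) (ξ j) (ξ j)).re ≤
      A * ((g (ξ i) (ξ i)).re * (g (ξ j) (ξ j)).re) -
        (R (ξ i) (ξ i) (ξ j) (ξ j)).re := by
    have h := mul_le_mul_of_nonneg_left
      (hermitian_mul_swap_re_le g hg_add hg_smul hg_conj hg_pos (ξ i) (ξ j)) hA.le
    have hd : (g (ξ i) (ξ i) * g (ξ j) (ξ j)).re =
        (g (ξ i) (ξ i)).re * (g (ξ j) (ξ j)).re := by simp [Complex.mul_re, im_zero]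
    simp only [S, Complex.sub_re, Complex.re_ofReal_mul, Complex.add_re, hd]
    linarith
  simp only [S_zero, Complex.zero_re, Finset.sum_const_zero, mul_zero, zero_add] at key
  have total := Finset.sum_le_sum fun (i : Fin n) (_ : i ∈ Finset.univ) =>
    Finset.sum_le_sum fun (j : Fin n) (_ : j ∈ Finset.univ) => S_le i j
  simp only [Finset.sum_sub_distrib, ← Finset.mul_sum, ← Finset.sum_mul] at total
  simp only [Complex.re_sum]
  rw [sq]
  linarith
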